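/- For all integers m, n ≥ 1 there exists a constant C > 0 depending only on m and n such that the following holds. Let i ∈ {1,…,n}, j, l ∈ {1,…,m}, let e = (1/√n)(1,…,1) ∈ ℝ^n, let x_0 ∈ ℝ^n, r > 0, M ≥ 100mn, set y_s = x_0 + sMr·e for s = 1,…,m, and let a be an H^1-atom associated with B(x_0, r). Define g = χ_{B(y_l,r)}, h_s = χ_{B(y_s,r)} for s ≠ l, c_0 = ∫_{B(y_1,r)×⋯×B(y_m,r)} K_j^{(i)}(z_l, z_1, …, z_{l−1}, x_0, z_{l+1}, …, z_m) dz_1⋯dz_m (which is nonzero), and h_l = a/c_0. Then for every locally integrable b : ℝ^n → ℝ with mean oscillation at most N, |∫_{ℝ^n} b(x) ( a(x) − Π_l(g, h_1, …, h_m)(x) ) dx| ≤ C N (log M)/M. -/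

import Mathlib

open MeasureTheory Metric

/-- The `i`-th component of the `m`-linear Riesz kernel on `ℝⁿ`:
`K_j^{(i)}(y₀, …, y_m) = (y₀^{(i)} − y_j^{(i)})/|(y₀ − y₁, …, y₀ − y_m)|^{mn+1}`,
where `j ∈ {1, …, m}` is encoded as `j : Fin m` acting on position `j.succ`. -/
noncomputable def rieszKernelComp (m n : ℕ) (j : Fin m) (i : Fin n)
    (y : Fin (m + 1) → EuclideanSpace ℝ (Fin n)) : ℝ :=
  (y 0 i - y j.succ i) / (Real.sqrt (∑ s : Fin m, ‖y 0 - y s.succ‖ ^ 2)) ^ (m * n + 1)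

/-- The unit vector `e = (1/√n)(1, …, 1) ∈ ℝⁿ`. -/
noncomputable def unitDiag (n : ℕ) : EuclideanSpace ℝ (Fin n) :=
  (EuclideanSpace.equiv (Fin n) ℝ).symm (fun _ => (Real.sqrt n)⁻¹)

/-- `T_j^{(i)}(h₁, …, h_m)(x) = ∫ K_j^{(i)}(x, z₁, …, z_m) ∏_s h_s(z_s) dz`. -/
noncomputable def Tmul (m n : ℕ) (j : Fin m) (i : Fin n)
    (h : Fin m → EuclideanSpace ℝ (Fin n) → ℝ) (x : EuclideanSpace ℝ (Fin n)) : ℝ :=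
  ∫ z : Fin m → EuclideanSpace ℝ (Fin n),
    rieszKernelComp m n j i (Fin.cons x z) * ∏ s, h s (z s)

/-- The `l`-th partial adjoint
`T_{j,l}^{*,(i)}(h₁, …, h_{l−1}, g, h_{l+1}, …, h_m)(x)
  = ∫ K_j^{(i)}(z_l, z₁, …, z_{l−1}, x, z_{l+1}, …, z_m) g(z_l) ∏_{s≠l} h_s(z_s) dz`. -/
noncomputable def TmulAdj (m n : ℕ) (j l : Fin m) (i : Fin n)
    (g : EuclideanSpace ℝ (Fin n) → ℝ) (h : Fin m → EuclideanSpace ℝ (Fin n) → ℝ)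
    (x : EuclideanSpace ℝ (Fin n)) : ℝ :=
  ∫ z : Fin m → EuclideanSpace ℝ (Fin n),
    rieszKernelComp m n j i (Function.update (Fin.cons (z l) z) l.succ x) *
      (g (z l) * ∏ s ∈ Finset.univ.erase l, h s (z s))

/-- `Π_l(g, h₁, …, h_m) = h_l · T_{j,l}^{*,(i)}(…, g, …) − g · T_j^{(i)}(h₁, …, h_m)`. -/
noncomputable def PiOp (m n : ℕ) (j l : Fin m) (i : Fin n)
    (g : EuclideanSpace ℝ (Fin n) → ℝ) (h : Fin m → EuclideanSpace ℝ (Fin n) → ℝ)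
    (x : EuclideanSpace ℝ (Fin n)) : ℝ :=
  h l x * TmulAdj m n j l i g h x - g x * Tmul m n j i h x

/-- If two quotients `u / A ^ q` and `u' / A' ^ q` have numerators and denominators that are
`δ`-close and `A, A' ≥ D`, then the quotients differ by at most `(q + 1) δ / D ^ q`. -/
theorem abs_div_pow_sub_div_pow_le {A A' D δ u u' : ℝ} (hD : 0 < D) (hA : D ≤ A) (hA' : D ≤ A')
    (hAA : |A - A'| ≤ δ) (hu : |u'| ≤ A') (huu : |u - u'| ≤ δ) (q : ℕ) :
    |u / A ^ q - u' / A' ^ q| ≤ (q + 1) * δ / D ^ q := by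
  have hA0 : 0 < A := hD.trans_le hA
  have hA0' : 0 < A' := hD.trans_le hA'
  have hδ : 0 ≤ δ := (abs_nonneg _).trans hAA
  induction q with
  | zero => simpa using huu
  | succ q ih =>
    have split : u / A ^ (q + 1) - u' / A' ^ (q + 1) =
        (u / A ^ q - u' / A' ^ q) / A + u' * (A' - A) / (A' ^ (q + 1) * A) := by
      field_simp
      ring
    have h1 : |(u / A ^ q - u' / A' ^ q) / A| ≤ ((q + 1) * δ / D ^ q) / D := by
      rw [abs_div, abs_of_pos hA0]
      gcongr
    have h2 : |u' * (A' - A) / (A' ^ (q + 1) * A)| ≤ δ / D ^ (q + 1) := by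
      rw [abs_div, abs_mul, abs_of_pos (by positivity : 0 < A' ^ (q + 1) * A), abs_sub_comm A' A]
      calc |u'| * |A - A'| / (A' ^ (q + 1) * A) ≤ A' * δ / (A' ^ (q + 1) * A) := by gcongr
        _ = δ / (A' ^ q * A) := by field_simp; ring
        _ ≤ δ / (D ^ q * D) := by gcongr
        _ = _ := by rw [pow_succ]
    rw [split]
    refine (abs_add_le _ _).trans ((add_le_add h1 h2).trans (le_of_eq ?_))
    push_cast
    field_simp
    ring

section Exchange

variable {m : ℕ} {E : Type*}

/-- Exchange the first component of a pair with the `l`-th coordinate of the second one. -/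
def exchange (l : Fin m) (q : E × (Fin m → E)) : E × (Fin m → E) :=
  (q.2 l, Function.update q.2 l q.1)

theorem exchange_involutive (l : Fin m) : Function.Involutive (exchange (E := E) l) := by
  rintro ⟨x, z⟩
  simp [exchange]

theorem measurePreserving_exchange [MeasureSpace E] [SigmaFinite (volume : Measure E)]
    (l : Fin m) : MeasurePreserving (exchange (E := E) l) volume volume := by
  have h1 := volume_preserving_piFinSuccAbove (fun _ : Fin (m + 1) => E) 0
  have h2 := volume_measurePreserving_piCongrLeft (fun _ : Fin (m + 1) => E) (Equiv.swap 0 l.succ)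
  have key : exchange (E := E) l =
      (MeasurableEquiv.piFinSuccAbove (fun _ : Fin (m + 1) => E) 0 ∘
        MeasurableEquiv.piCongrLeft (fun _ : Fin (m + 1) => E) (Equiv.swap 0 l.succ)) ∘
      (MeasurableEquiv.piFinSuccAbove (fun _ : Fin (m + 1) => E) 0).symm := by
    have apply_swap : ∀ (w : Fin (m + 1) → E) (k : Fin (m + 1)),
        MeasurableEquiv.piCongrLeft (fun _ : Fin (m + 1) => E) (Equiv.swap 0 l.succ) w k =
          w (Equiv.swap 0 l.succ k) := by
      intro w k
      conv_lhs => rw [← Equiv.swap_apply_self 0 l.succ k]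
      rw [MeasurableEquiv.coe_piCongrLeft, Equiv.piCongrLeft_apply_apply]
    funext q
    have hcons : (MeasurableEquiv.piFinSuccAbove (fun _ : Fin (m + 1) => E) 0).symm q =
        Fin.cons q.1 q.2 := Fin.insertNth_zero' q.1 q.2
    refine Prod.ext ?_ (funext fun s => ?_)
    · simp only [Function.comp_apply, hcons]
      change q.2 l = MeasurableEquiv.piCongrLeft (fun _ : Fin (m + 1) => E) (Equiv.swap 0 l.succ)
        (Fin.cons q.1 q.2) 0
      rw [apply_swap, Equiv.swap_apply_left, Fin.cons_succ]
    · simp only [Function.comp_apply, hcons]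
      change Function.update q.2 l q.1 s = MeasurableEquiv.piCongrLeft (fun _ : Fin (m + 1) => E)
        (Equiv.swap 0 l.succ) (Fin.cons q.1 q.2) (Fin.succAbove 0 s)
      rw [apply_swap, Fin.zero_succAbove]
      rcases eq_or_ne s l with rfl | hs
      · simp
      · rw [Equiv.swap_apply_of_ne_of_ne (Fin.succ_ne_zero s) (by simpa using hs)]
        simp [hs]
  rw [key]
  exact (h1.comp h2).comp h1.symm

theorem integral_comp_exchange [MeasureSpace E] [SigmaFinite (volume : Measure E)]
    (l : Fin m) (f : E × (Fin m → E) → ℝ) : ∫ q, f (exchange l q) = ∫ q, f q :=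
  (measurePreserving_exchange l).integral_comp'
    (f := MeasurableEquiv.ofInvolutive (exchange l) (exchange_involutive l)
      (measurePreserving_exchange l).measurable) f

theorem integrable_comp_exchange [MeasureSpace E] [SigmaFinite (volume : Measure E)]
    (l : Fin m) {f : E × (Fin m → E) → ℝ} (hf : Integrable f) :
    Integrable fun q => f (exchange l q) :=
  (measurePreserving_exchange l).integrable_comp_of_integrable hf

/-- A mean zero function of the `l`-th variable integrates to zero against any function of the
remaining variables. -/
theorem integral_eval_mul_eq_zero [MeasureSpace E] [SigmaFinite (volume : Measure E)]
    (l : Fin m) {f : E → ℝ} (hf : ∫ x, f x = 0) {G : (Fin m → E) → ℝ}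
    (hG : ∀ z u, G (Function.update z l u) = G z) {χ : E → ℝ} (hχ : ∫ x, χ x ≠ 0) :
    ∫ z : Fin m → E, f (z l) * G z = 0 := by
  have h1 : ∫ q : E × (Fin m → E), χ q.1 * (f (q.2 l) * G q.2) =
      (∫ x, χ x) * ∫ z : Fin m → E, f (z l) * G z :=
    integral_prod_mul (μ := (volume : Measure E)) (ν := (volume : Measure (Fin m → E)))
      χ fun z => f (z l) * G z
  have h2 : ∫ q : E × (Fin m → E), f q.1 * (χ (q.2 l) * G q.2) =
      (∫ x, f x) * ∫ z : Fin m → E, χ (z l) * G z :=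
    integral_prod_mul (μ := (volume : Measure E)) (ν := (volume : Measure (Fin m → E)))
      f fun z => χ (z l) * G z
  rw [← integral_comp_exchange l] at h1
  have h3 : (∫ x, χ x) * ∫ z : Fin m → E, f (z l) * G z = 0 := by
    rw [← h1, ← zero_mul (∫ z : Fin m → E, χ (z l) * G z), ← hf, ← h2]
    congr 1
    funext q
    simp only [exchange, Function.update_self, hG]
    ring
  exact (mul_eq_zero.1 h3).resolve_left hχ

/-- Partial duality: exchanging the roles of the outer variable and the `l`-th variable. -/
theorem integral_mul_partialAdjoint [MeasureSpace E] [SigmaFinite (volume : Measure E)]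
    (l : Fin m) {k : E → (Fin m → E) → ℝ} {g : E → ℝ} {h : Fin m → E → ℝ}
    (hint : Integrable fun q : E × (Fin m → E) => k q.1 q.2 * (g q.1 * ∏ s, h s (q.2 s))) :
    Integrable (fun x => g x * ∫ z : Fin m → E, k x z * ∏ s, h s (z s)) ∧
    Integrable (fun x => h l x * ∫ z : Fin m → E, k (z l) (Function.update z l x) *
      (g (z l) * ∏ s ∈ Finset.univ.erase l, h s (z s))) ∧
    ∫ x, h l x * ∫ z : Fin m → E, k (z l) (Function.update z l x) *
      (g (z l) * ∏ s ∈ Finset.univ.erase l, h s (z s)) =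
    ∫ x, g x * ∫ z : Fin m → E, k x z * ∏ s, h s (z s) := by
  have hexch := integrable_comp_exchange l hint
  have heq := integral_comp_exchange l
    fun q : E × (Fin m → E) => k q.1 q.2 * (g q.1 * ∏ s, h s (q.2 s))
  have hfun : ∀ q : E × (Fin m → E),
      k (exchange l q).1 (exchange l q).2 *
        (g (exchange l q).1 * ∏ s, h s ((exchange l q).2 s)) =
      h l q.1 * (k (q.2 l) (Function.update q.2 l q.1) *
        (g (q.2 l) * ∏ s ∈ Finset.univ.erase l, h s (q.2 s))) := by
    intro q
    have hprod : ∏ s ∈ Finset.univ.erase l, h s (Function.update q.2 l q.1 s) =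
        ∏ s ∈ Finset.univ.erase l, h s (q.2 s) :=
      Finset.prod_congr rfl fun s hs => by rw [Function.update_of_ne (Finset.ne_of_mem_erase hs)]
    simp only [exchange]
    rw [← Finset.mul_prod_erase _ _ (Finset.mem_univ l), hprod, Function.update_self]
    ring
  have hfun' : ∀ q : E × (Fin m → E), k q.1 q.2 * (g q.1 * ∏ s, h s (q.2 s)) =
      g q.1 * (k q.1 q.2 * ∏ s, h s (q.2 s)) := fun q => by ring
  simp only [hfun] at hexch heq
  simp only [hfun'] at hint heq
  refine ⟨?_, ?_, ?_⟩
  · simpa only [integral_const_mul] using hint.integral_prod_left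
  · simpa only [integral_const_mul] using hexch.integral_prod_left
  · have e1 := integral_prod _ hexch
    have e2 := integral_prod _ hint
    simp only [integral_const_mul] at e1 e2
    rw [← e1, ← e2]
    exact heq

end Exchange

theorem abs_setAverage_sub_setAverage_le {E : Type*} [MeasureSpace E] {b : E → ℝ} {A B : Set E} (hAB : A ⊆ B)
    (hA : 0 < volume.real A) (hB : volume B ≠ ⊤) (hb : IntegrableOn b B) :
    |(⨍ z in A, b z) - ⨍ z in B, b z| ≤
      volume.real B / volume.real A * ⨍ w in B, |b w - ⨍ z in B, b z| := by
  set c := ⨍ z in B, b z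
  have hAfin : volume A ≠ ⊤ := measure_ne_top_of_subset hAB hB
  have hB0 : 0 < volume.real B := hA.trans_le (measureReal_mono hAB hB)
  have hbB : IntegrableOn (fun w => b w - c) B := hb.sub (integrableOn_const hB)
  have h1 : (⨍ z in A, b z) - c = (volume.real A)⁻¹ * ∫ z in A, (b z - c) := by
    rw [integral_sub (hb.mono_set hAB) (integrableOn_const hAfin), setAverage_eq,
      setIntegral_const, smul_eq_mul, smul_eq_mul]
    field_simp
  have h2 : |∫ z in A, (b z - c)| ≤ ∫ z in B, |b z - c| :=
    (abs_integral_le_integral_abs).trans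
      (setIntegral_mono_set hbB.abs (.of_forall fun _ => abs_nonneg _) hAB.eventuallyLE)
  rw [h1, abs_mul, abs_of_pos (inv_pos.2 hA), setAverage_eq _ _ B, smul_eq_mul]
  calc (volume.real A)⁻¹ * |∫ z in A, (b z - c)|
      ≤ (volume.real A)⁻¹ * ∫ z in B, |b z - c| := by gcongr
    _ = _ := by field_simp

theorem volume_real_ball_pos {E : Type*} [PseudoMetricSpace E] [ProperSpace E] [MeasureSpace E]
    [(volume : Measure E).IsOpenPosMeasure] [IsFiniteMeasureOnCompacts (volume : Measure E)]
    (x : E) {r : ℝ} (hr : 0 < r) : 0 < volume.real (ball x r) :=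
  ENNReal.toReal_pos (measure_ball_pos _ _ hr).ne' measure_ball_lt_top.ne

section MeanOscillation

variable {E : Type*} [NormedAddCommGroup E] [NormedSpace ℝ E] [FiniteDimensional ℝ E]
  [MeasureSpace E] [(volume : Measure E).IsAddHaarMeasure]

variable {b : E → ℝ} {N : ℝ}

/-- A function of bounded mean oscillation paired with a function supported in a ball. -/
theorem integrable_and_abs_integral_mul_sub_le (hb : LocallyIntegrable b)
    (hN : ∀ (x : E) (t : ℝ), 0 < t → ⨍ w in ball x t, |b w - ⨍ z in ball x t, b z| ≤ N)
    {u : E} {s η : ℝ} (hs : 0 < s) {f : E → ℝ} (hf : AEStronglyMeasurable f)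
    (hsupp : ∀ x, x ∉ ball u s → f x = 0) (hη : ∀ᵐ x, |f x| ≤ η) :
    Integrable f ∧ Integrable (fun x => b x * f x) ∧
    |(∫ x, b x * f x) - (⨍ z in ball u s, b z) * ∫ x, f x| ≤
      η * volume.real (ball u s) * N := by
  set c := ⨍ z in ball u s, b z
  have hV := volume_real_ball_pos u hs
  have hint : IntegrableOn b (ball u s) :=
    (hb.integrableOn_isCompact (isCompact_closedBall u s)).mono_set ball_subset_closedBall
  have hconst : ∀ c : ℝ, IntegrableOn (fun _ : E => c) (ball u s) := fun c =>
    integrableOn_const measure_ball_lt_top.ne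
  have hη' : ∀ᵐ x ∂volume.restrict (ball u s), ‖f x‖ ≤ η := ae_restrict_of_ae hη
  have hfint : Integrable f := by
    rw [← integrableOn_iff_integrable_of_support_subset (s := ball u s)
      (fun x hx => by_contra fun h => hx (hsupp x h))]
    exact (hconst η).mono' hf.restrict hη'
  have hbf : Integrable fun x => b x * f x := by
    rw [← integrableOn_iff_integrable_of_support_subset (s := ball u s)
      (fun x hx => by_contra fun h => hx (by simp [hsupp x h]))]
    exact hint.mul_bdd hf.restrict hη'
  refine ⟨hfint, hbf, ?_⟩
  have hosc : IntegrableOn (fun x => |b x - c|) (ball u s) := (hint.sub (hconst c)).abs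
  have hη0 : 0 ≤ η := by
    obtain ⟨x, hx⟩ := hη.exists
    exact (abs_nonneg _).trans hx
  have hset : (∫ x, b x * f x) - c * ∫ x, f x = ∫ x in ball u s, (b x - c) * f x := by
    rw [← integral_const_mul, ← integral_sub hbf (hfint.const_mul c),
      setIntegral_eq_integral_of_forall_compl_eq_zero (fun x hx => by simp [hsupp x hx])]
    simp only [sub_mul]
  rw [hset]
  have h1 : ‖∫ x in ball u s, (b x - c) * f x‖ ≤ ∫ x in ball u s, η * |b x - c| := by
    refine norm_integral_le_of_norm_le (hosc.const_mul η) ?_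
    filter_upwards [hη'] with x hx
    rw [norm_mul, mul_comm]
    gcongr
    exact le_rfl
  have h2 : ∫ x in ball u s, |b x - c| ≤ volume.real (ball u s) * N := by
    have h := hN u s hs
    rwa [setAverage_eq, smul_eq_mul, inv_mul_le_iff₀ hV] at h
  rw [integral_const_mul] at h1
  calc _ ≤ η * ∫ x in ball u s, |b x - c| := h1
    _ ≤ η * (volume.real (ball u s) * N) := by gcongr
    _ = _ := by ring

variable [BorelSpace E]

theorem volume_real_ball_of_pos (x : E) {r : ℝ} (hr : 0 < r) :
    volume.real (ball x r) = r ^ Module.finrank ℝ E * volume.real (ball (0 : E) 1) := by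
  rw [Measure.real, Measure.addHaar_ball_of_pos _ _ hr, ENNReal.toReal_mul,
    ENNReal.toReal_ofReal (by positivity), Measure.real]

theorem abs_ballAverage_sub_ballAverage_double_le (hb : LocallyIntegrable b)
    (hN : ∀ (x : E) (t : ℝ), 0 < t → ⨍ w in ball x t, |b w - ⨍ z in ball x t, b z| ≤ N)
    {u v : E} {s : ℝ} (hs : 0 < s) (huv : dist u v ≤ s) :
    |(⨍ z in ball u s, b z) - ⨍ z in ball v (2 * s), b z| ≤ 2 ^ Module.finrank ℝ E * N := by
  have hω := volume_real_ball_pos (0 : E) one_pos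
  have hint : IntegrableOn b (ball v (2 * s)) :=
    (hb.integrableOn_isCompact (isCompact_closedBall v (2 * s))).mono_set ball_subset_closedBall
  refine (abs_setAverage_sub_setAverage_le (ball_subset_ball' (by linarith))
    (volume_real_ball_pos u hs) measure_ball_lt_top.ne hint).trans ?_
  rw [volume_real_ball_of_pos u hs, volume_real_ball_of_pos v (by positivity : 0 < 2 * s), mul_pow]
  have : (2 : ℝ) ^ Module.finrank ℝ E * s ^ Module.finrank ℝ E * volume.real (ball (0 : E) 1) /
      (s ^ Module.finrank ℝ E * volume.real (ball (0 : E) 1)) = 2 ^ Module.finrank ℝ E := by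
    field_simp
  rw [this]
  gcongr
  exact hN _ _ (by positivity)

theorem abs_ballAverage_sub_ballAverage_dyadic_le (hb : LocallyIntegrable b)
    (hN : ∀ (x : E) (t : ℝ), 0 < t → ⨍ w in ball x t, |b w - ⨍ z in ball x t, b z| ≤ N)
    (u : E) {s : ℝ} (hs : 0 < s) (k : ℕ) :
    |(⨍ z in ball u s, b z) - ⨍ z in ball u (2 ^ k * s), b z| ≤
      k * (2 ^ Module.finrank ℝ E * N) := by
  induction k with
  | zero => simp
  | succ k ih =>
    have h := abs_ballAverage_sub_ballAverage_double_le hb hN (u := u) (v := u)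
      (s := 2 ^ k * s) (by positivity) (by rw [dist_self]; positivity)
    rw [← mul_assoc, ← pow_succ'] at h
    refine (abs_sub_le _ _ _).trans ((add_le_add ih h).trans (le_of_eq ?_))
    push_cast
    ring

/-- The averages of a function of bounded mean oscillation over two balls of radius `s` at
distance at most `2 ^ k * s` differ by `O(k)`. -/
theorem abs_ballAverage_sub_ballAverage_le (hb : LocallyIntegrable b)
    (hN : ∀ (x : E) (t : ℝ), 0 < t → ⨍ w in ball x t, |b w - ⨍ z in ball x t, b z| ≤ N)
    {u v : E} {s : ℝ} (hs : 0 < s) {k : ℕ} (huv : dist u v ≤ 2 ^ k * s) :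
    |(⨍ z in ball u s, b z) - ⨍ z in ball v s, b z| ≤
      (2 * k + 2) * (2 ^ Module.finrank ℝ E * N) := by
  have h1 := abs_ballAverage_sub_ballAverage_dyadic_le hb hN u hs k
  have h2 := abs_ballAverage_sub_ballAverage_double_le hb hN (by positivity) huv
  have h3 := abs_ballAverage_sub_ballAverage_dyadic_le hb hN v hs (k + 1)
  rw [← mul_assoc, ← pow_succ'] at h2
  rw [abs_sub_comm] at h3
  refine (abs_sub_le _ _ _).trans ((add_le_add_left (abs_sub_le _ _ _) _).trans
    ((add_le_add (add_le_add h1 h2) h3).trans (le_of_eq ?_)))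
  push_cast
  ring

/-- Pairing a function of bounded mean oscillation with a mean zero function that splits into two
bounded pieces supported in balls of the same radius. -/
theorem integrable_and_abs_integral_mul_add_le (hb : LocallyIntegrable b)
    (hN : ∀ (x : E) (t : ℝ), 0 < t → ⨍ w in ball x t, |b w - ⨍ z in ball x t, b z| ≤ N)
    {u v : E} {s η : ℝ} (hs : 0 < s) {k : ℕ} (huv : dist u v ≤ 2 ^ k * s)
    {f₁ f₂ : E → ℝ} (hf₁ : AEStronglyMeasurable f₁) (hf₂ : AEStronglyMeasurable f₂)
    (hsupp₁ : ∀ x, x ∉ ball u s → f₁ x = 0) (hsupp₂ : ∀ x, x ∉ ball v s → f₂ x = 0)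
    (hη₁ : ∀ᵐ x, |f₁ x| ≤ η) (hη₂ : ∀ᵐ x, |f₂ x| ≤ η) (hzero : (∫ x, f₁ x) + ∫ x, f₂ x = 0) :
    Integrable (fun x => b x * (f₁ x + f₂ x)) ∧
    |∫ x, b x * (f₁ x + f₂ x)| ≤ η * (s ^ Module.finrank ℝ E * volume.real (ball (0 : E) 1)) *
      (2 + (2 * k + 2) * 2 ^ Module.finrank ℝ E) * N := by
  obtain ⟨hi₁, hbi₁, h₁⟩ := integrable_and_abs_integral_mul_sub_le hb hN hs hf₁ hsupp₁ hη₁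
  obtain ⟨hi₂, hbi₂, h₂⟩ := integrable_and_abs_integral_mul_sub_le hb hN hs hf₂ hsupp₂ hη₂
  have havg := abs_ballAverage_sub_ballAverage_le hb hN hs huv
  rw [← volume_real_ball_of_pos u hs]
  rw [volume_real_ball_of_pos v hs, ← volume_real_ball_of_pos u hs] at h₂
  set V := volume.real (ball u s)
  set cu := ⨍ z in ball u s, b z
  set cv := ⨍ z in ball v s, b z
  have hη0 : 0 ≤ η := by
    obtain ⟨x, hx⟩ := hη₁.exists
    exact (abs_nonneg _).trans hx
  have hI : |∫ x, f₁ x| ≤ η * V := by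
    rw [← setIntegral_eq_integral_of_forall_compl_eq_zero hsupp₁]
    have hη₁' : ∀ᵐ x ∂volume.restrict (ball u s), ‖f₁ x‖ ≤ η := ae_restrict_of_ae hη₁
    exact norm_setIntegral_le_of_norm_le_const_ae measure_ball_lt_top hη₁'
  have hsum : ∀ x, b x * (f₁ x + f₂ x) = b x * f₁ x + b x * f₂ x := fun x => mul_add _ _ _
  simp only [hsum]
  refine ⟨hbi₁.add hbi₂, ?_⟩
  rw [integral_add hbi₁ hbi₂]
  have hsplit : (∫ x, b x * f₁ x) + ∫ x, b x * f₂ x =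
      (((∫ x, b x * f₁ x) - cu * ∫ x, f₁ x) + ((∫ x, b x * f₂ x) - cv * ∫ x, f₂ x)) +
        (cu - cv) * ∫ x, f₁ x := by
    rw [eq_neg_of_add_eq_zero_right hzero]
    ring
  have h₃ : |(cu - cv) * ∫ x, f₁ x| ≤ (2 * k + 2) * (2 ^ Module.finrank ℝ E * N) * (η * V) := by
    rw [abs_mul]
    gcongr
    exact (abs_nonneg _).trans havg
  rw [hsplit]
  refine (abs_add_le _ _).trans ((add_le_add (abs_add_le _ _) le_rfl).trans
    ((add_le_add (add_le_add h₁ h₂) h₃).trans (le_of_eq ?_)))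
  ring

end MeanOscillation

theorem norm_unitDiag {n : ℕ} (hn : 1 ≤ n) : ‖unitDiag n‖ = 1 := by
  have hn0 : (0 : ℝ) < n := by exact_mod_cast hn
  rw [EuclideanSpace.norm_eq, Real.sqrt_eq_one]
  simp [unitDiag, hn0.ne']

section Kernel

variable {m n : ℕ} {j l : Fin m} {i : Fin n}

theorem rieszKernelComp_cons (p : EuclideanSpace ℝ (Fin n))
    (w : Fin m → EuclideanSpace ℝ (Fin n)) :
    rieszKernelComp m n j i (Fin.cons p w) =
      (p i - w j i) / ‖WithLp.toLp 2 fun s => p - w s‖ ^ (m * n + 1) := by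
  simp [rieszKernelComp, PiLp.norm_eq_of_L2]

theorem measurable_rieszKernelComp : Measurable (rieszKernelComp m n j i) := by
  unfold rieszKernelComp
  fun_prop

theorem abs_sub_apply_le_norm_toLp (p : EuclideanSpace ℝ (Fin n))
    (w : Fin m → EuclideanSpace ℝ (Fin n)) :
    |p i - w j i| ≤ ‖WithLp.toLp 2 fun s => p - w s‖ :=
  (PiLp.norm_apply_le (p - w j) i).trans
    (PiLp.norm_apply_le (WithLp.toLp 2 fun s => p - w s) j)

theorem abs_rieszKernelComp_cons_le {D : ℝ} (hD : 0 < D) {p : EuclideanSpace ℝ (Fin n)}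
    {w : Fin m → EuclideanSpace ℝ (Fin n)} (hw : D ≤ ‖p - w l‖) :
    |rieszKernelComp m n j i (Fin.cons p w)| ≤ (D ^ (m * n))⁻¹ := by
  have hA : D ≤ ‖WithLp.toLp 2 fun s => p - w s‖ :=
    hw.trans (PiLp.norm_apply_le (WithLp.toLp 2 fun s => p - w s) l)
  rw [rieszKernelComp_cons, abs_div, abs_of_nonneg (pow_nonneg (norm_nonneg _) _)]
  have hnum := abs_sub_apply_le_norm_toLp (j := j) (i := i) p w
  set A := ‖WithLp.toLp 2 fun s => p - w s‖
  have hA0 : 0 < A := hD.trans_le hA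
  calc |p i - w j i| / A ^ (m * n + 1) ≤ A / A ^ (m * n + 1) := by gcongr
    _ = (A ^ (m * n))⁻¹ := by rw [pow_succ]; field_simp
    _ ≤ (D ^ (m * n))⁻¹ := by gcongr

/-- Regularity of the Riesz kernel in the `l`-th variable. -/
theorem abs_rieszKernelComp_update_sub_le {D δ : ℝ} (hD : 0 < D)
    {p x x' : EuclideanSpace ℝ (Fin n)} (w : Fin m → EuclideanSpace ℝ (Fin n))
    (hx : D ≤ ‖p - x‖) (hx' : D ≤ ‖p - x'‖) (hδ : ‖x - x'‖ ≤ δ) :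
    |rieszKernelComp m n j i (Fin.cons p (Function.update w l x)) -
      rieszKernelComp m n j i (Fin.cons p (Function.update w l x'))| ≤
      (m * n + 2) * δ / D ^ (m * n + 1) := by
  have hA : ∀ u, ‖p - u‖ ≤ ‖WithLp.toLp 2 fun s => p - Function.update w l u s‖ := fun u => by
    simpa using PiLp.norm_apply_le (WithLp.toLp 2 fun s => p - Function.update w l u s) l
  rw [rieszKernelComp_cons, rieszKernelComp_cons]
  refine (abs_div_pow_sub_div_pow_le hD (hx.trans (hA x)) (hx'.trans (hA x')) (δ := δ) ?_
    (abs_sub_apply_le_norm_toLp _ _) ?_ _).trans_eq ?_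
  · refine (abs_norm_sub_norm_le _ _).trans ?_
    have : (WithLp.toLp 2 fun s => p - Function.update w l x s) -
        (WithLp.toLp 2 fun s => p - Function.update w l x' s) =
        PiLp.single 2 l (x' - x) := by
      ext s : 1
      rcases eq_or_ne s l with rfl | hs
      · simp
      · simp [hs]
    rw [this, PiLp.norm_single, norm_sub_rev]
    exact hδ
  · rcases eq_or_ne j l with rfl | hj
    · have := (PiLp.norm_apply_le (x - x') i).trans hδ
      rw [Real.norm_eq_abs, PiLp.sub_apply, abs_sub_comm] at this
      simpa using this
    · simpa [hj] using (norm_nonneg _).trans hδ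
  · push_cast
    ring

/-- Nondegeneracy of the Riesz kernel at well separated points in the diagonal direction. -/
theorem exists_le_mul_rieszKernelComp (hn : 1 ≤ n) (j l : Fin m) (i : Fin n)
    (x₀ : EuclideanSpace ℝ (Fin n)) {r L : ℝ} (hr : 0 < r) (hL : 100 * m * n * r ≤ L) :
    ∃ σ : ℝ, |σ| = 1 ∧ ∀ z : Fin m → EuclideanSpace ℝ (Fin n),
      (∀ s : Fin m, z s ∈ ball (x₀ + ((((s : ℕ) : ℝ) + 1) * L) • unitDiag n) r) →
      L / (2 * n) / (2 * m ^ 2 * L) ^ (m * n + 1) ≤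
        σ * rieszKernelComp m n j i (Fin.cons (z l) (Function.update z l x₀)) := by
  have hm1 : (1 : ℝ) ≤ m := by exact_mod_cast Fin.pos l
  have hn1 : (1 : ℝ) ≤ n := by exact_mod_cast hn
  have hmn : 1 ≤ (m : ℝ) * n := one_le_mul_of_one_le_of_one_le hm1 hn1
  have hL100 : 100 * r ≤ L := by nlinarith
  have hL0 : 0 < L := by linarith
  have hLn : 100 * r ≤ L / n := by
    rw [le_div_iff₀ (by positivity)]
    nlinarith [mul_pos (mul_pos hr (by positivity : (0 : ℝ) < n)) (by positivity : (0 : ℝ) < m)]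
  let t : Fin m → ℝ := Function.update (fun s => ((s : ℕ) : ℝ) + 1) l 0
  have ht : ∀ s, 0 ≤ t s ∧ t s ≤ m := by
    intro s
    rcases eq_or_ne s l with rfl | hs
    · simp [t]
    · have : ((s : ℕ) : ℝ) + 1 ≤ m := by exact_mod_cast s.isLt
      simp only [t, Function.update_of_ne hs]
      exact ⟨by positivity, this⟩
  have hl : ((l : ℕ) : ℝ) + 1 ≤ m := by exact_mod_cast l.isLt
  have hl0 : (0 : ℝ) ≤ ((l : ℕ) : ℝ) + 1 := by positivity
  obtain ⟨σ, hσ, hσt⟩ : ∃ σ : ℝ, |σ| = 1 ∧ 1 ≤ σ * (((l : ℕ) : ℝ) + 1 - t j) := by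
    rcases eq_or_ne j l with rfl | hj
    · exact ⟨1, by simp, by simp [t]⟩
    · simp only [t, Function.update_of_ne hj]
      rcases lt_or_gt_of_ne hj with h | h
      · have : ((j : ℕ) : ℝ) + 1 ≤ (l : ℕ) := by exact_mod_cast h
        exact ⟨1, by simp, by linarith⟩
      · have : ((l : ℕ) : ℝ) + 1 ≤ (j : ℕ) := by exact_mod_cast h
        exact ⟨-1, by simp, by linarith⟩
  refine ⟨σ, hσ, fun z hz => ?_⟩
  set w := Function.update z l x₀ with hw
  have hpl : ‖z l - (x₀ + ((((l : ℕ) : ℝ) + 1) * L) • unitDiag n)‖ ≤ r :=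
    (mem_ball_iff_norm.1 (hz l)).le
  have hws : ∀ s, ‖w s - (x₀ + (t s * L) • unitDiag n)‖ ≤ r := by
    intro s
    rcases eq_or_ne s l with rfl | hs
    · simpa [w, t] using hr.le
    · simpa [w, t, hs] using (mem_ball_iff_norm.1 (hz s)).le
  have hdecomp : ∀ s, z l - w s = (z l - (x₀ + ((((l : ℕ) : ℝ) + 1) * L) • unitDiag n)) -
      (w s - (x₀ + (t s * L) • unitDiag n)) +
        ((((l : ℕ) : ℝ) + 1 - t s) * L) • unitDiag n := by
    intro s
    module
  have hupper : ‖WithLp.toLp 2 fun s => z l - w s‖ ≤ 2 * m ^ 2 * L := by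
    have hs : ∀ s, ‖z l - w s‖ ≤ 2 * m * L := by
      intro s
      have hab : |((l : ℕ) : ℝ) + 1 - t s| ≤ m := by
        rw [abs_le]
        constructor <;> linarith [(ht s).1, (ht s).2]
      have h1 : ‖((((l : ℕ) : ℝ) + 1 - t s) * L) • unitDiag n‖ ≤ m * L := by
        rw [norm_smul, norm_unitDiag hn, mul_one, norm_mul, Real.norm_eq_abs, Real.norm_eq_abs,
          abs_of_pos hL0]
        gcongr
      rw [hdecomp s]
      refine (norm_add_le _ _).trans ((add_le_add ((norm_sub_le _ _).trans
        (add_le_add hpl (hws s))) h1).trans ?_)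
      nlinarith
    rw [PiLp.norm_eq_of_L2]
    refine Real.sqrt_le_iff.2 ⟨by positivity, ?_⟩
    calc ∑ s, ‖z l - w s‖ ^ 2 ≤ ∑ _s : Fin m, (2 * m * L) ^ 2 := by
          gcongr with s
          exact hs s
      _ = m * (2 * m * L) ^ 2 := by simp
      _ ≤ (m * m) * (2 * m * L) ^ 2 := by gcongr; nlinarith
      _ = _ := by ring
  have hnum : L / (2 * n) ≤ σ * (z l i - w j i) := by
    have e1 := (PiLp.norm_apply_le (z l - (x₀ + ((((l : ℕ) : ℝ) + 1) * L) • unitDiag n)) i).trans hpl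
    have e2 := (PiLp.norm_apply_le (w j - (x₀ + (t j * L) • unitDiag n)) i).trans (hws j)
    set d₁ := (z l - (x₀ + ((((l : ℕ) : ℝ) + 1) * L) • unitDiag n)) i
    set d₂ := (w j - (x₀ + (t j * L) • unitDiag n)) i
    have hco : z l i - w j i = d₁ - d₂ + (((l : ℕ) : ℝ) + 1 - t j) * L * (Real.sqrt n)⁻¹ := by
      have := congrArg (fun v : EuclideanSpace ℝ (Fin n) => v i) (hdecomp j)
      simpa [unitDiag, d₁, d₂] using this
    have hsq : (n : ℝ)⁻¹ ≤ (Real.sqrt n)⁻¹ := by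
      have : Real.sqrt n ≤ n := Real.sqrt_le_iff.2 ⟨by positivity, by nlinarith⟩
      have h0 : 0 < Real.sqrt n := Real.sqrt_pos.2 (by positivity)
      gcongr
    have herr : -(2 * r) ≤ σ * (d₁ - d₂) := by
      have : |σ * (d₁ - d₂)| ≤ 2 * r := by
        rw [abs_mul, hσ, one_mul]
        exact (abs_sub _ _).trans (by rw [← Real.norm_eq_abs, ← Real.norm_eq_abs]; linarith)
      exact (abs_le.1 this).1
    have hmain : L / n ≤ σ * (((l : ℕ) : ℝ) + 1 - t j) * (L * (Real.sqrt n)⁻¹) := by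
      rw [div_eq_mul_inv]
      calc L * (n : ℝ)⁻¹ ≤ L * (Real.sqrt n)⁻¹ := by gcongr
        _ = 1 * (L * (Real.sqrt n)⁻¹) := (one_mul _).symm
        _ ≤ _ := by gcongr
    have hhalf : L / (2 * n) = L / n / 2 := by field_simp
    rw [hco, hhalf]
    nlinarith
  rw [rieszKernelComp_cons, ← mul_div_assoc]
  have hpos : 0 < ‖WithLp.toLp 2 fun s => z l - w s‖ := by
    refine (norm_pos_iff.2 fun h => ?_)
    have h0 : z l - w j = 0 := congrFun (congrArg WithLp.ofLp h) j
    have h1 : z l i - w j i = 0 := congrArg (fun v : EuclideanSpace ℝ (Fin n) => v i) h0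
    rw [h1, mul_zero] at hnum
    exact absurd hnum (not_le.2 (by positivity))
  have hL2 : 0 ≤ L / (2 * n) := by positivity
  gcongr
  exact hL2.trans hnum

end Kernel

section Weighted

variable {m : ℕ} {E : Type*} [MeasureSpace E]

theorem integrable_mul_of_abs_le {F W : E → ℝ} (hW : Integrable W) (hF : AEStronglyMeasurable F)
    {β : ℝ} (hβ : ∀ z, W z ≠ 0 → |F z| ≤ β) : Integrable fun z => F z * W z := by
  refine (hW.norm.const_mul β).mono' (hF.mul hW.1) (.of_forall fun z => ?_)
  rw [norm_mul]
  rcases eq_or_ne (W z) 0 with h | h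
  · simp [h]
  · gcongr
    exact hβ z h

/-- A slowly varying function integrated against a product weight one of whose factors has
mean zero. -/
theorem abs_integral_mul_prod_le [SigmaFinite (volume : Measure E)] {F : (Fin m → E) → ℝ}
    (hF : Measurable F) {h : Fin m → E → ℝ} (hh : ∀ s, Integrable (h s)) {l : Fin m}
    (hl : ∫ x, h l x = 0) {S : Set E} (hS : ∀ x, x ∉ S → h l x = 0) {x₀ : E} (hx₀ : x₀ ∈ S)
    {β ε : ℝ} (hβ : ∀ z, z l ∈ S → |F z| ≤ β)
    (hε : ∀ z, z l ∈ S → |F z - F (Function.update z l x₀)| ≤ ε)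
    {χ : E → ℝ} (hχ : ∫ x, χ x ≠ 0) :
    |∫ z, F z * ∏ s, h s (z s)| ≤ ε * ∏ s, ∫ x, |h s x| := by
  have hsupp : ∀ z : Fin m → E, ∏ s, h s (z s) ≠ 0 → z l ∈ S := fun z hz =>
    by_contra fun hzS => hz (Finset.prod_eq_zero (Finset.mem_univ l) (hS _ hzS))
  have hW : Integrable fun z : Fin m → E => ∏ s, h s (z s) := Integrable.fintype_prod hh
  have hW' : Integrable fun z : Fin m → E => ∏ s, |h s (z s)| :=
    Integrable.fintype_prod fun s => (hh s).abs
  have hi₁ : Integrable fun z => F z * ∏ s, h s (z s) :=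
    integrable_mul_of_abs_le hW hF.aestronglyMeasurable fun z hz => hβ z (hsupp z hz)
  have hupd : Measurable fun z : Fin m → E => Function.update z l x₀ :=
    measurable_update'.comp (measurable_id.prodMk measurable_const)
  have hi₂ : Integrable fun z => F (Function.update z l x₀) * ∏ s, h s (z s) :=
    integrable_mul_of_abs_le hW (hF.comp hupd).aestronglyMeasurable
      fun z _ => hβ _ (by simpa using hx₀)
  have hzero : ∫ z, F (Function.update z l x₀) * ∏ s, h s (z s) = 0 := by
    rw [← integral_eval_mul_eq_zero l hl (G := fun z => F (Function.update z l x₀) *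
      ∏ s ∈ Finset.univ.erase l, h s (z s)) (fun z u => ?_) hχ]
    · refine integral_congr_ae (.of_forall fun z => ?_)
      simp only
      rw [← Finset.mul_prod_erase _ _ (Finset.mem_univ l)]
      ring
    · have hprod : ∏ s ∈ Finset.univ.erase l, h s (Function.update z l u s) =
          ∏ s ∈ Finset.univ.erase l, h s (z s) :=
        Finset.prod_congr rfl fun s hs => by rw [Function.update_of_ne (Finset.ne_of_mem_erase hs)]
      simp only [Function.update_idem, hprod]
  rw [← integral_fintype_prod_volume_eq_prod (fun s x => |h s x|), ← integral_const_mul,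
    ← sub_zero (∫ z, F z * ∏ s, h s (z s)), ← hzero, ← integral_sub hi₁ hi₂]
  rw [← Real.norm_eq_abs]
  refine norm_integral_le_of_norm_le (hW'.const_mul ε) (.of_forall fun z => ?_)
  rw [← sub_mul, norm_mul, Real.norm_eq_abs, Real.norm_eq_abs, Finset.abs_prod]
  by_cases hz : z l ∈ S
  · gcongr
    exact hε z hz
  · rw [Finset.prod_eq_zero (Finset.mem_univ l) (by rw [hS _ hz, abs_zero])]
    simp

end Weighted

theorem prod_indicator_one_eq {m : ℕ} {E : Type*} (B : Fin m → Set E) (z : Fin m → E) :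
    ∏ s, (B s).indicator (fun _ => (1 : ℝ)) (z s) =
      (Set.univ.pi B).indicator (fun _ => 1) z := by
  by_cases hz : z ∈ Set.univ.pi B
  · rw [Set.indicator_of_mem hz]
    exact Finset.prod_eq_one fun s _ => Set.indicator_of_mem (hz s (Set.mem_univ s)) _
  · rw [Set.indicator_of_notMem hz]
    obtain ⟨s, hs⟩ : ∃ s, z s ∉ B s := by simpa using hz
    exact Finset.prod_eq_zero (Finset.mem_univ s) (Set.indicator_of_notMem hs _)

theorem TmulAdj_indicator {m n : ℕ} {j l : Fin m} {i : Fin n}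
    {B : Fin m → Set (EuclideanSpace ℝ (Fin n))} (hB : ∀ s, MeasurableSet (B s))
    (f : EuclideanSpace ℝ (Fin n) → ℝ) (x : EuclideanSpace ℝ (Fin n)) :
    TmulAdj m n j l i ((B l).indicator fun _ => 1)
      (Function.update (fun s => (B s).indicator fun _ => 1) l f) x =
      ∫ z in Set.univ.pi B,
        rieszKernelComp m n j i (Function.update (Fin.cons (z l) z) l.succ x) := by
  rw [TmulAdj, ← integral_indicator (.univ_pi hB)]
  refine integral_congr_ae (.of_forall fun z => ?_)
  have hprod : ∏ s ∈ Finset.univ.erase l,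
      Function.update (fun s => (B s).indicator fun _ => (1 : ℝ)) l f s (z s) =
      ∏ s ∈ Finset.univ.erase l, (B s).indicator (fun _ => (1 : ℝ)) (z s) :=
    Finset.prod_congr rfl fun s hs => by rw [Function.update_of_ne (Finset.ne_of_mem_erase hs)]
  simp only
  rw [hprod, Finset.mul_prod_erase Finset.univ
    (fun s => (B s).indicator (fun _ => (1 : ℝ)) (z s)) (Finset.mem_univ l),
    prod_indicator_one_eq]
  by_cases hz : z ∈ Set.univ.pi B
  · rw [Set.indicator_of_mem hz, Set.indicator_of_mem hz, mul_one]
  · rw [Set.indicator_of_notMem hz, Set.indicator_of_notMem hz, mul_zero]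

theorem exists_le_two_pow_and_le_log {m M : ℝ} (hm : 1 ≤ m) (hM : 100 ≤ M) (hmM : m ≤ M) :
    1 ≤ Real.log M ∧ ∃ k : ℕ, m * M ≤ 2 ^ k ∧ 2 * (k : ℝ) + 2 ≤ 12 * Real.log M := by
  have hM0 : 0 < M := by linarith
  have hlog : 1 ≤ Real.log M := by
    rw [Real.le_log_iff_exp_le hM0]
    linarith [Real.exp_one_lt_d9]
  refine ⟨hlog, ?_⟩
  obtain ⟨k, hk, hk'⟩ := exists_nat_pow_near (by nlinarith : 1 ≤ m * M) one_lt_two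
  refine ⟨k + 1, hk'.le, ?_⟩
  have h1 : k * Real.log 2 ≤ 2 * Real.log M := by
    rw [← Real.log_pow, two_mul, ← Real.log_mul hM0.ne' hM0.ne']
    exact Real.log_le_log (by positivity) (hk.trans (by gcongr))
  have h2 := Real.log_two_gt_d9
  push_cast
  nlinarith

theorem measurable_rieszKernelComp_cons {m n : ℕ} {j : Fin m} {i : Fin n} :
    Measurable fun q : EuclideanSpace ℝ (Fin n) × (Fin m → EuclideanSpace ℝ (Fin n)) =>
      rieszKernelComp m n j i (Fin.cons q.1 q.2) := by
  refine measurable_rieszKernelComp.comp (measurable_pi_lambda _ fun s => ?_)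
  refine Fin.cases ?_ (fun s => ?_) s
  · simpa using measurable_fst
  · simpa only [Fin.cons_succ] using (measurable_pi_apply s).fun_comp measurable_snd

theorem volume_real_univ_pi {ι : Type*} [Fintype ι] {E : Type*} [MeasureSpace E]
    [SigmaFinite (volume : Measure E)] (B : ι → Set E) :
    volume.real (Set.univ.pi B) = ∏ s, volume.real (B s) := by
  simp [Measure.real, volume_pi_pi, ENNReal.toReal_prod]

theorem integral_abs_indicator_one {E : Type*} [MeasureSpace E] {B : Set E}
    (hB : MeasurableSet B) :
    ∫ x, |B.indicator (fun _ => (1 : ℝ)) x| = volume.real B := by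
  rw [← integral_indicator_one hB]
  refine integral_congr_ae (.of_forall fun x => ?_)
  exact abs_of_nonneg (Set.indicator_nonneg (fun _ _ => zero_le_one) x)

section Factorization

variable {m n : ℕ} {j l : Fin m} {i : Fin n} {x₀ : EuclideanSpace ℝ (Fin n)} {r L : ℝ}

theorem half_le_norm_sub (hn : 1 ≤ n) (hL : 100 * r ≤ L)
    {p x : EuclideanSpace ℝ (Fin n)}
    (hp : p ∈ ball (x₀ + ((((l : ℕ) : ℝ) + 1) * L) • unitDiag n) r) (hx : x ∈ ball x₀ r) :
    L / 2 ≤ ‖p - x‖ := by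
  have hr : 0 < r := pos_of_mem_ball hx
  set c := x₀ + ((((l : ℕ) : ℝ) + 1) * L) • unitDiag n with hc
  have h1 : ‖p - c‖ < r := mem_ball_iff_norm.1 hp
  have h2 : ‖x - x₀‖ < r := mem_ball_iff_norm.1 hx
  have hl : (0 : ℝ) ≤ ((l : ℕ) : ℝ) := by positivity
  have h3 : L ≤ ‖c - x₀‖ := by
    rw [hc, add_sub_cancel_left, norm_smul, norm_unitDiag hn, Real.norm_eq_abs, mul_one]
    refine le_trans ?_ (le_abs_self _)
    nlinarith
  have h4 : c - x₀ = (p - x) - (p - c) + (x - x₀) := by abel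
  rw [h4] at h3
  have := h3.trans ((norm_add_le _ _).trans (add_le_add_left (norm_sub_le _ _) _))
  linarith

theorem measurable_rieszKernelComp_update (x : EuclideanSpace ℝ (Fin n)) :
    Measurable fun z : Fin m → EuclideanSpace ℝ (Fin n) =>
      rieszKernelComp m n j i (Function.update (Fin.cons (z l) z) l.succ x) := by
  simp only [← Fin.cons_update]
  have hupd : Measurable fun z : Fin m → EuclideanSpace ℝ (Fin n) => Function.update z l x :=
    measurable_update'.comp (measurable_id.prodMk measurable_const)
  have hpair : Measurable fun z : Fin m → EuclideanSpace ℝ (Fin n) =>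
      (z l, Function.update z l x) := (measurable_pi_apply l).prodMk hupd
  exact measurable_rieszKernelComp_cons.comp hpair

theorem integrableOn_rieszKernelComp_update (hn : 1 ≤ n) (hr : 0 < r) (hL : 100 * r ≤ L)
    {x : EuclideanSpace ℝ (Fin n)} (hx : x ∈ ball x₀ r) :
    IntegrableOn (fun z : Fin m → EuclideanSpace ℝ (Fin n) =>
      rieszKernelComp m n j i (Function.update (Fin.cons (z l) z) l.succ x))
      (Set.univ.pi fun s : Fin m => ball (x₀ + ((((s : ℕ) : ℝ) + 1) * L) • unitDiag n) r) := by
  have hbox : MeasurableSet (Set.univ.pi fun s : Fin m =>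
      ball (x₀ + ((((s : ℕ) : ℝ) + 1) * L) • unitDiag n) r) :=
    .univ_pi fun s => measurableSet_ball
  refine Measure.integrableOn_of_bounded (M := ((L / 2) ^ (m * n))⁻¹) ?_
    (measurable_rieszKernelComp_update x).aestronglyMeasurable ?_
  · rw [volume_pi_pi]
    exact ENNReal.prod_ne_top fun s _ => measure_ball_lt_top.ne
  · refine (ae_restrict_iff' hbox).2 (.of_forall fun z hz => ?_)
    rw [← Fin.cons_update]
    refine abs_rieszKernelComp_cons_le (l := l) (by linarith) ?_
    rw [Function.update_self]
    exact half_le_norm_sub hn hL (hz l (Set.mem_univ l)) hx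

theorem abs_setIntegral_rieszKernelComp_sub_le (hn : 1 ≤ n) (hr : 0 < r) (hL : 100 * r ≤ L)
    {x : EuclideanSpace ℝ (Fin n)} (hx : x ∈ ball x₀ r)
    {B : Fin m → Set (EuclideanSpace ℝ (Fin n))}
    (hB : B = fun s : Fin m => ball (x₀ + ((((s : ℕ) : ℝ) + 1) * L) • unitDiag n) r) :
    |(∫ z in Set.univ.pi B,
        rieszKernelComp m n j i (Function.update (Fin.cons (z l) z) l.succ x)) -
      ∫ z in Set.univ.pi B,
        rieszKernelComp m n j i (Function.update (Fin.cons (z l) z) l.succ x₀)| ≤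
      (m * n + 2) * r / (L / 2) ^ (m * n + 1) * volume.real (Set.univ.pi B) := by
  subst hB
  rw [← integral_sub (integrableOn_rieszKernelComp_update hn hr hL hx)
    (integrableOn_rieszKernelComp_update hn hr hL (mem_ball_self hr))]
  rw [← Real.norm_eq_abs]
  refine norm_setIntegral_le_of_norm_le_const ?_ fun z hz => ?_
  · rw [volume_pi_pi]
    exact ENNReal.prod_lt_top fun s _ => measure_ball_lt_top
  · have hzl := hz l (Set.mem_univ l)
    rw [← Fin.cons_update, ← Fin.cons_update]
    exact abs_rieszKernelComp_update_sub_le (by linarith) z (half_le_norm_sub hn hL hzl hx)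
      (half_le_norm_sub hn hL hzl (mem_ball_self hr)) (mem_ball_iff_norm.1 hx).le

theorem le_abs_setIntegral_rieszKernelComp (hn : 1 ≤ n) (hr : 0 < r)
    (hL : 100 * m * n * r ≤ L) (hL' : 100 * r ≤ L)
    {B : Fin m → Set (EuclideanSpace ℝ (Fin n))}
    (hB : B = fun s : Fin m => ball (x₀ + ((((s : ℕ) : ℝ) + 1) * L) • unitDiag n) r) :
    L / (2 * n) / (2 * m ^ 2 * L) ^ (m * n + 1) * volume.real (Set.univ.pi B) ≤
      |∫ z in Set.univ.pi B,
        rieszKernelComp m n j i (Function.update (Fin.cons (z l) z) l.succ x₀)| := by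
  subst hB
  obtain ⟨σ, hσ, hlow⟩ := exists_le_mul_rieszKernelComp hn j l i x₀ hr hL
  have hint := integrableOn_rieszKernelComp_update (m := m) (j := j) (l := l) (i := i) hn hr hL'
    (mem_ball_self (x := x₀) hr)
  refine (setIntegral_ge_of_const_le_real (f := fun z => σ *
    rieszKernelComp m n j i (Function.update (Fin.cons (z l) z) l.succ x₀))
    (.univ_pi fun s => measurableSet_ball) ?_ (fun z hz => ?_) (hint.const_mul σ)).trans ?_
  · rw [volume_pi_pi]
    exact ENNReal.prod_ne_top fun s _ => measure_ball_lt_top.ne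
  · rw [← Fin.cons_update]
    exact hlow z fun s => hz s (Set.mem_univ s)
  · rw [integral_const_mul]
    refine (le_abs_self _).trans ?_
    rw [abs_mul, hσ, one_mul]

theorem abs_Tmul_le (hn : 1 ≤ n) (hr : 0 < r) (hL : 100 * r ≤ L)
    {h : Fin m → EuclideanSpace ℝ (Fin n) → ℝ} (hh : ∀ s, Integrable (h s))
    (hl : ∫ x, h l x = 0) (hsupp : ∀ x, x ∉ ball x₀ r → h l x = 0)
    {p : EuclideanSpace ℝ (Fin n)}
    (hp : p ∈ ball (x₀ + ((((l : ℕ) : ℝ) + 1) * L) • unitDiag n) r) :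
    |Tmul m n j i h p| ≤
      (m * n + 2) * r / (L / 2) ^ (m * n + 1) * ∏ s, ∫ x, |h s x| := by
  refine abs_integral_mul_prod_le (F := fun z => rieszKernelComp m n j i (Fin.cons p z))
    (measurable_rieszKernelComp_cons.comp measurable_prodMk_left) hh hl hsupp (mem_ball_self hr)
    (fun z hz => abs_rieszKernelComp_cons_le (by linarith) (half_le_norm_sub hn hL hp hz))
    (fun z hz => ?_) (χ := (ball x₀ r).indicator 1) ?_
  · simpa using abs_rieszKernelComp_update_sub_le (l := l) (j := j) (i := i) (by linarith) z
      (half_le_norm_sub hn hL hp hz) (half_le_norm_sub hn hL hp (mem_ball_self hr))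
      (mem_ball_iff_norm.1 hz).le
  · rw [integral_indicator_one measurableSet_ball]
    exact (volume_real_ball_pos x₀ hr).ne'

theorem integral_mul_TmulAdj (hn : 1 ≤ n) (hr : 0 < r) (hL : 100 * r ≤ L)
    {g : EuclideanSpace ℝ (Fin n) → ℝ} {h : Fin m → EuclideanSpace ℝ (Fin n) → ℝ}
    (hg : Integrable g) (hh : ∀ s, Integrable (h s))
    (hgsupp : ∀ x, x ∉ ball (x₀ + ((((l : ℕ) : ℝ) + 1) * L) • unitDiag n) r → g x = 0)
    (hsupp : ∀ x, x ∉ ball x₀ r → h l x = 0) :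
    Integrable (fun x => g x * Tmul m n j i h x) ∧
    Integrable (fun x => h l x * TmulAdj m n j l i g h x) ∧
    ∫ x, h l x * TmulAdj m n j l i g h x = ∫ x, g x * Tmul m n j i h x := by
  simp only [TmulAdj, Tmul, ← Fin.cons_update]
  refine integral_mul_partialAdjoint l (k := fun p w => rieszKernelComp m n j i (Fin.cons p w))
    (integrable_mul_of_abs_le (hg.mul_prod (Integrable.fintype_prod hh))
      measurable_rieszKernelComp_cons.aestronglyMeasurable (β := ((L / 2) ^ (m * n))⁻¹) ?_)
  rintro ⟨p, w⟩ hpw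
  have hp : p ∈ ball (x₀ + ((((l : ℕ) : ℝ) + 1) * L) • unitDiag n) r :=
    by_contra fun hp => hpw (by simp [hgsupp p hp])
  have hw : w l ∈ ball x₀ r := by_contra fun hw => hpw (mul_eq_zero_of_right _
    (Finset.prod_eq_zero (Finset.mem_univ l) (hsupp _ hw)))
  exact abs_rieszKernelComp_cons_le (by linarith) (half_le_norm_sub hn hL hp hw)

end Factorization

/-- pairing form of the approximate factorization of an atom.  With
`y_s = x₀ + sMr·e`, `g = χ_{B(y_l,r)}`, `h_s = χ_{B(y_s,r)}` for `s ≠ l`, and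
`h_l = a/c₀` where `c₀` is the partial-adjoint integral (which is nonzero), for every
locally integrable `b` with mean oscillation at most `N`,
`|∫ b (a − Π_l(g, h₁, …, h_m))| ≤ C N (log M)/M`. -/
theorem atom_approximate_factorization_pairing (m n : ℕ) (hm : 1 ≤ m) (hn : 1 ≤ n) :
    ∃ C : ℝ, 0 < C ∧ ∀ (i : Fin n) (j l : Fin m)
      (x₀ : EuclideanSpace ℝ (Fin n)) (r M : ℝ), 0 < r → (100 * m * n : ℝ) ≤ M →
      ∀ a : EuclideanSpace ℝ (Fin n) → ℝ, Measurable a →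
      (∀ z, z ∉ Metric.ball x₀ r → a z = 0) →
      (∀ᵐ z, |a z| ≤ (r ^ n)⁻¹) → (∫ z, a z) = 0 →
      let y : Fin m → EuclideanSpace ℝ (Fin n) :=
        fun s => x₀ + ((((s : ℕ) : ℝ) + 1) * (M * r)) • unitDiag n
      let c₀ : ℝ := ∫ z in Set.univ.pi (fun s : Fin m => Metric.ball (y s) r),
        rieszKernelComp m n j i (Function.update (Fin.cons (z l) z) l.succ x₀)
      let g : EuclideanSpace ℝ (Fin n) → ℝ :=
        (Metric.ball (y l) r).indicator (fun _ => (1 : ℝ))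
      let h : Fin m → EuclideanSpace ℝ (Fin n) → ℝ :=
        Function.update
          (fun s => (Metric.ball (y s) r).indicator (fun _ => (1 : ℝ)))
          l (fun x => a x / c₀)
      c₀ ≠ 0 ∧
      ∀ (b : EuclideanSpace ℝ (Fin n) → ℝ) (N : ℝ), LocallyIntegrable b volume →
      (∀ (x : EuclideanSpace ℝ (Fin n)) (t : ℝ), 0 < t →
        ⨍ w in Metric.ball x t, |b w - ⨍ z in Metric.ball x t, b z| ≤ N) →
      Integrable (fun x => b x * (a x - PiOp m n j l i g h x)) volume ∧
      |∫ x, b x * (a x - PiOp m n j l i g h x)| ≤ C * N * Real.log M / M := by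
  have hm1 : (1 : ℝ) ≤ m := by exact_mod_cast hm
  have hn1 : (1 : ℝ) ≤ n := by exact_mod_cast hn
  have hmn : 1 ≤ (m : ℝ) * n := one_le_mul_of_one_le_of_one_le hm1 hn1
  set ω := volume.real (ball (0 : EuclideanSpace ℝ (Fin n)) 1)
  have hω : 0 < ω := volume_real_ball_pos _ one_pos
  set C₁ : ℝ := (m * n + 2) * 2 ^ (m * n + 1) * (2 * n) * (2 * m ^ 2) ^ (m * n + 1)
  have hC₁ : 0 < C₁ := by positivity
  refine ⟨C₁ * ω * (2 + 12 * 2 ^ n), by positivity, ?_⟩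
  intro i j l x₀ r M hr hM a ha hasupp habd ha0
  have hM100 : 100 ≤ M := by nlinarith
  have hM0 : 0 < M := by linarith
  have hL : 100 * m * n * r ≤ M * r := by gcongr
  have hL' : 100 * r ≤ M * r := by gcongr
  have hLpos : 0 < M * r := by positivity
  intro y c₀ g h
  set B : Fin m → Set (EuclideanSpace ℝ (Fin n)) := fun s => ball (y s) r
  set V := r ^ n * ω
  have hV : 0 < V := by positivity
  have hVball : ∀ x : EuclideanSpace ℝ (Fin n), volume.real (ball x r) = V := fun x => by
    rw [volume_real_ball_of_pos x hr, finrank_euclideanSpace_fin]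
  have hbox : volume.real (Set.univ.pi B) = V ^ m := by
    simp [volume_real_univ_pi, B, hVball]
  set ε : ℝ := (m * n + 2) * r / (M * r / 2) ^ (m * n + 1)
  set κ : ℝ := M * r / (2 * n) / (2 * m ^ 2 * (M * r)) ^ (m * n + 1)
  have hκ : 0 < κ := by positivity
  have hε : 0 < ε := by positivity
  have hεκ : ε = C₁ / M * κ := by
    simp only [ε, κ, C₁, div_pow, mul_pow]
    field_simp
  have hc₀κ : κ * V ^ m ≤ |c₀| := by
    rw [← hbox]
    exact le_abs_setIntegral_rieszKernelComp hn hr hL hL' rfl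
  have hc₀pos : 0 < |c₀| := lt_of_lt_of_le (by positivity) hc₀κ
  have hc₀ : c₀ ≠ 0 := abs_pos.1 hc₀pos
  have hratio : ε * V ^ m / |c₀| ≤ C₁ / M := by
    rw [div_le_iff₀ hc₀pos, hεκ, mul_assoc]
    gcongr
  refine ⟨hc₀, fun b N hb hN => ?_⟩
  have hg : Integrable g :=
    (integrable_indicator_iff measurableSet_ball).2 (integrableOn_const measure_ball_lt_top.ne)
  obtain ⟨haint, -, -⟩ := integrable_and_abs_integral_mul_sub_le hb hN hr
    ha.aestronglyMeasurable hasupp habd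
  have hhl : h l = fun x => a x / c₀ := Function.update_self ..
  have hhs : ∀ s, s ≠ l → h s = (B s).indicator fun _ => 1 := fun s hs =>
    Function.update_of_ne hs ..
  have hhint : ∀ s, Integrable (h s) := by
    intro s
    rcases eq_or_ne s l with rfl | hs
    · rw [hhl]
      exact haint.div_const c₀
    · rw [hhs s hs]
      exact (integrable_indicator_iff measurableSet_ball).2
        (integrableOn_const measure_ball_lt_top.ne)
  have hhlsupp : ∀ x, x ∉ ball x₀ r → h l x = 0 := fun x hx => by simp [hhl, hasupp x hx]
  have hhl0 : ∫ x, h l x = 0 := by rw [hhl, integral_div, ha0, zero_div]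
  have hgsupp : ∀ x, x ∉ ball (y l) r → g x = 0 := fun x hx => Set.indicator_of_notMem hx _
  obtain ⟨hgT, hhT, hdual⟩ := integral_mul_TmulAdj (j := j) (i := i) hn hr hL' hg hhint hgsupp
    hhlsupp
  set S := TmulAdj m n j l i g h
  set T := Tmul m n j i h
  have hS : ∀ x ∈ ball x₀ r, |S x - c₀| ≤ ε * V ^ m := fun x hx => by
    rw [← hbox, show S x = _ from TmulAdj_indicator (B := B) (fun s => measurableSet_ball) _ x]
    exact abs_setIntegral_rieszKernelComp_sub_le hn hr hL' hx rfl
  have haL1 : ∫ x, |a x| ≤ (r ^ n)⁻¹ * V := by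
    rw [← setIntegral_eq_integral_of_forall_compl_eq_zero
      (fun x hx => by rw [hasupp x hx, abs_zero] : ∀ x, x ∉ ball x₀ r → |a x| = 0), ← hVball x₀]
    have hbd : ∀ᵐ x ∂volume.restrict (ball x₀ r), ‖|a x|‖ ≤ (r ^ n)⁻¹ := by
      simpa using ae_restrict_of_ae habd
    exact (le_abs_self _).trans (norm_setIntegral_le_of_norm_le_const_ae measure_ball_lt_top hbd)
  have hprod : ∏ s, ∫ x, |h s x| ≤ (r ^ n)⁻¹ / |c₀| * V ^ m := by
    have hs : ∀ s, ∫ x, |h s x| ≤ (if s = l then (r ^ n)⁻¹ / |c₀| else 1) * V := by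
      intro s
      split_ifs with hsl
      · subst hsl
        simp only [hhl, abs_div, integral_div]
        rw [div_mul_eq_mul_div]
        gcongr
      · rw [hhs s hsl, integral_abs_indicator_one measurableSet_ball, hVball, one_mul]
    refine (Finset.prod_le_prod (fun s _ => integral_nonneg fun x => abs_nonneg _)
      fun s _ => hs s).trans_eq ?_
    rw [Finset.prod_mul_distrib]
    simp
  have hT : ∀ p ∈ ball (y l) r, |T p| ≤ (r ^ n)⁻¹ * (C₁ / M) := fun p hp => by
    refine (abs_Tmul_le hn hr hL' hhint hhl0 hhlsupp hp).trans ?_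
    calc ε * ∏ s, ∫ x, |h s x| ≤ ε * ((r ^ n)⁻¹ / |c₀| * V ^ m) := by gcongr
      _ = (r ^ n)⁻¹ * (ε * V ^ m / |c₀|) := by ring
      _ ≤ _ := by gcongr
  obtain ⟨hlog, k, hk, hk'⟩ := exists_le_two_pow_and_le_log hm1 hM100 (by nlinarith : (m : ℝ) ≤ M)
  have hdist : dist x₀ (y l) ≤ 2 ^ k * r := by
    have hl : ((l : ℕ) : ℝ) + 1 ≤ m := by exact_mod_cast l.isLt
    rw [dist_comm, dist_eq_norm, add_sub_cancel_left, norm_smul, norm_unitDiag hn, mul_one,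
      Real.norm_of_nonneg (by positivity)]
    calc (((l : ℕ) : ℝ) + 1) * (M * r) ≤ m * (M * r) := by gcongr
      _ = m * M * r := by ring
      _ ≤ _ := by gcongr
  have hf₁ : ∀ᵐ x, |a x - h l x * S x| ≤ (r ^ n)⁻¹ * (C₁ / M) := by
    filter_upwards [habd] with x hx
    by_cases hxB : x ∈ ball x₀ r
    · have : a x - h l x * S x = a x * ((c₀ - S x) / c₀) := by
        rw [hhl]
        field_simp
      rw [this, abs_mul, abs_div, abs_sub_comm]
      exact mul_le_mul hx ((div_le_div_of_nonneg_right (hS x hxB) hc₀pos.le).trans hratio)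
        (by positivity) (by positivity)
    · rw [hasupp x hxB, hhlsupp x hxB]
      simpa using by positivity
  have hf₂ : ∀ᵐ x, |g x * T x| ≤ (r ^ n)⁻¹ * (C₁ / M) := .of_forall fun x => by
    by_cases hx : x ∈ ball (y l) r
    · rw [show g x = 1 from Set.indicator_of_mem hx _, one_mul]
      exact hT x hx
    · rw [hgsupp x hx]
      simpa using by positivity
  obtain ⟨hint, hbound⟩ := integrable_and_abs_integral_mul_add_le hb hN hr hdist
    (haint.sub hhT).1 hgT.1 (fun x hx => by simp [hasupp x hx, hhlsupp x hx])
    (fun x hx => by simp [hgsupp x hx]) hf₁ hf₂ (by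
      simp only [Pi.sub_apply]
      rw [integral_sub haint hhT, ha0, hdual]
      ring)
  have hPi : ∀ x, b x * (a x - PiOp m n j l i g h x) =
      b x * ((a x - h l x * S x) + g x * T x) := fun x => by
    simp only [PiOp, S, T]
    ring
  simp only [hPi]
  refine ⟨hint, hbound.trans ?_⟩
  have hN0 : 0 ≤ N := by
    refine le_trans ?_ (hN x₀ r hr)
    rw [setAverage_eq]
    exact smul_nonneg (by positivity) (integral_nonneg fun x => abs_nonneg _)
  rw [finrank_euclideanSpace_fin]
  have hlast : 2 + (2 * (k : ℝ) + 2) * 2 ^ n ≤ (2 + 12 * 2 ^ n) * Real.log M := by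
    have : (0 : ℝ) < 2 ^ n := by positivity
    nlinarith
  calc (r ^ n)⁻¹ * (C₁ / M) * (r ^ n * ω) * (2 + (2 * k + 2) * 2 ^ n) * N
      ≤ (r ^ n)⁻¹ * (C₁ / M) * (r ^ n * ω) * ((2 + 12 * 2 ^ n) * Real.log M) * N := by gcongr
    _ = C₁ * ω * (2 + 12 * 2 ^ n) * N * Real.log M / M := by field_simp
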